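/- Let (X,d) be a compact metric space and μ a Borel probability measure on X with full support. Let n ≥ 2 be an integer and set v_n(s) := (∫_0^s (sin t)^{n−1} dt)/(∫_0^π (sin t)^{n−1} dt) for s ∈ [0,π]. Assume diam(X,d) ≤ π and μ(B_s(x)) ≥ v_n(s) for every x ∈ X and every s ∈ [0,π], where B_s(x) is the closed ball of radius s around x. Then the mean distance satisfies md(X) := ∫_{X×X} d(x,y) dμ(x)dμ(y) ≤ π/2. -/

import Mathlib

open MeasureTheory Metric Real

lemma integral_sin_pow_add_reflect (m : ℕ) (s : ℝ) :
    (∫ t in (0 : ℝ)..s, sin t ^ m) + ∫ t in (0 : ℝ)..(π - s), sin t ^ m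
      = ∫ t in (0 : ℝ)..π, sin t ^ m := by
  have hi (a b : ℝ) : IntervalIntegrable (fun t => sin t ^ m) volume a b :=
    (by fun_prop : Continuous fun t => sin t ^ m).intervalIntegrable a b
  have h := intervalIntegral.integral_comp_sub_left (fun t => sin t ^ m) π (a := s) (b := π)
  simp only [sin_pi_sub, sub_self] at h
  rw [← h, intervalIntegral.integral_add_adjacent_intervals (hi _ _) (hi _ _)]

lemma continuous_integral_sin_pow (m : ℕ) :
    Continuous fun s : ℝ => ∫ t in (0 : ℝ)..s, sin t ^ m :=
  intervalIntegral.continuous_primitive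
    (fun a b => (by fun_prop : Continuous fun t => sin t ^ m).intervalIntegrable a b) 0

lemma integral_one_sub_sin_pow_ratio (m : ℕ) :
    ∫ s in (0 : ℝ)..π, (1 - (∫ t in (0 : ℝ)..s, sin t ^ m) / ∫ t in (0 : ℝ)..π, sin t ^ m)
      = π / 2 := by
  set F : ℝ → ℝ := fun s => 1 - (∫ t in (0 : ℝ)..s, sin t ^ m) / ∫ t in (0 : ℝ)..π, sin t ^ m
    with hF
  have hcont : Continuous F := by
    have := continuous_integral_sin_pow m
    fun_prop
  have hpos : (∫ t in (0 : ℝ)..π, sin t ^ m) ≠ 0 := (integral_sin_pow_pos m).ne'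
  have hreflect (s : ℝ) : F (π - s) = 1 - F s := by
    have := integral_sin_pow_add_reflect m s
    simp only [hF]
    field_simp
    linarith
  have h := intervalIntegral.integral_comp_sub_left F π (a := 0) (b := π)
  simp only [hreflect, sub_self, sub_zero] at h
  rw [intervalIntegral.integral_sub (by simp) (hcont.intervalIntegrable _ _)] at h
  simp only [intervalIntegral.integral_const, smul_eq_mul, mul_one, sub_zero] at h
  linarith

/-- Lower bounds on the measures of balls give an upper bound on the mean distance to a point. -/
lemma integral_dist_le_of_le_measureReal_closedBall {X : Type*} [PseudoMetricSpace X]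
    [MeasurableSpace X] [OpensMeasurableSpace X]
    (μ : Measure X) [IsProbabilityMeasure μ] {x : X} {D : ℝ} (hD : 0 ≤ D)
    (hdist : ∀ y, dist x y ≤ D) (hint : Integrable (fun y => dist x y) μ) {v : ℝ → ℝ}
    (hv : IntervalIntegrable v volume 0 D)
    (hball : ∀ s ∈ Set.Icc 0 D, v s ≤ μ.real (closedBall x s)) :
    ∫ y, dist x y ∂μ ≤ ∫ s in (0 : ℝ)..D, (1 - v s) := by
  rw [hint.integral_eq_integral_meas_lt (.of_forall fun _ => dist_nonneg),
    intervalIntegral.integral_of_le hD,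
    setIntegral_eq_of_subset_of_forall_sdiff_eq_zero measurableSet_Ioi
      (Set.Ioc_subset_Ioi_self : Set.Ioc 0 D ⊆ Set.Ioi 0)]
  · refine integral_mono_of_nonneg (.of_forall fun _ => measureReal_nonneg)
      ((intervalIntegrable_const.sub hv).1) ?_
    refine (ae_restrict_iff' measurableSet_Ioc).2 (.of_forall fun s hs => ?_)
    have hcompl : {y | s < dist x y} = (closedBall x s)ᶜ := by
      ext y
      simp [dist_comm]
    change μ.real {y | s < dist x y} ≤ 1 - v s
    rw [hcompl, probReal_compl_eq_one_sub isClosed_closedBall.measurableSet]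
    linarith [hball s ⟨hs.1.le, hs.2⟩]
  · intro s hs
    have hDs : D < s := by
      by_contra! h
      exact hs.2 ⟨hs.1, h⟩
    have hempty : {y | s < dist x y} = ∅ := by
      ext y
      simpa using (hdist y).trans hDs.le
    simp [hempty]

/-- Mean-distance bound (part I of the sphere theorem): if `(X,d)` is a compact metric
space with a Borel probability measure `μ` of full support, `n ≥ 2`, `diam X ≤ π`, and
`μ (closedBall x s) ≥ v n s` for all `x` and `s ∈ [0,π]`, where
`v n s = (∫₀^s sin t ^ (n-1) dt)/(∫₀^π sin t ^ (n-1) dt)`, then the mean distance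
`md(X) = ∫_{X×X} d(x,y) dμ(x)dμ(y)` is at most `π/2`. -/
theorem mean_distance_le {X : Type*} [MetricSpace X] [CompactSpace X]
    [MeasurableSpace X] [BorelSpace X]
    (μ : Measure X) [IsProbabilityMeasure μ] [μ.IsOpenPosMeasure]
    (n : ℕ) (hn : 2 ≤ n)
    (hdiam : Metric.diam (Set.univ : Set X) ≤ π)
    (hball : ∀ (x : X), ∀ s ∈ Set.Icc (0 : ℝ) π,
      (∫ t in (0 : ℝ)..s, Real.sin t ^ (n - 1))
          / (∫ t in (0 : ℝ)..π, Real.sin t ^ (n - 1))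
        ≤ (μ (Metric.closedBall x s)).toReal) :
    ∫ p : X × X, dist p.1 p.2 ∂(μ.prod μ) ≤ π / 2 := by
  have hintegrable {Y : Type _} [TopologicalSpace Y] [CompactSpace Y] [MeasurableSpace Y]
      [OpensMeasurableSpace Y] (ν : Measure Y) [IsFiniteMeasure ν] {f : Y → ℝ}
      (hf : Continuous f) : Integrable f ν :=
    hf.integrable_of_hasCompactSupport (HasCompactSupport.of_compactSpace f)
  have hpoint (x : X) : ∫ y, dist x y ∂μ ≤ π / 2 := by
    rw [← integral_one_sub_sin_pow_ratio (n - 1)]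
    refine integral_dist_le_of_le_measureReal_closedBall μ pi_pos.le
      (fun y => (dist_le_diam_of_mem isCompact_univ.isBounded trivial trivial).trans hdiam)
      (hintegrable μ (by fun_prop)) ?_ (hball x)
    exact ((continuous_integral_sin_pow (n - 1)).div_const _).intervalIntegrable _ _
  have hprod := hintegrable (μ.prod μ) (continuous_dist (α := X))
  rw [integral_prod _ hprod]
  calc ∫ x, ∫ y, dist x y ∂μ ∂μ ≤ ∫ _, π / 2 ∂μ :=
        integral_mono hprod.integral_prod_left (integrable_const _) hpoint
    _ = π / 2 := by simp
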